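/- arXiv:1406.7279 — 2 statements merged into one kernel-verified Lean document; each statement's English description precedes it below -/
import Mathlib

section
/- Let x_1, …, x_n be vectors in ℝ^m satisfying the ℓ₂² triangle inequalities, and let c_{ij} ≥ 0 and d_{ij} ≥ 0 for 1 ≤ i < j ≤ n be cost and demand weights with D = Σ_{k<l} d_{kl} ‖x_k − x_l‖² > 0. Let σ_1 ≥ σ_2 ≥ … ≥ σ_N ≥ 0 be the eigenvalues, in descending order, of the Gram matrix of the family {√(d_{ij}) (x_i − x_j)}_{i<j} (N = n(n−1)/2), and let r ∈ [N] be such that Σ_{t=1}^{r} σ_t > 0. Define y_i ∈ ℝ^N by y_i(k, l) = d_{kl} ‖x_k − x_l‖² ⟨x_i − x_l, x_k − x_l⟩ / D. Then Σ_{i<j} d_{ij} ‖y_i − y_j‖₁ > 0 and (Σ_{i<j} c_{ij} ‖y_i − y_j‖₁) / (Σ_{i<j} d_{ij} ‖y_i − y_j‖₁) ≤ Φ(SDP) · r · (Σ_{t=1}^{N} σ_t / Σ_{t=1}^{r} σ_t)², where Φ(SDP) = (Σ_{i<j} c_{ij} ‖x_i − x_j‖²) / D. -/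
open RealInnerProductSpace Finset

/-- The index type of unordered pairs `{(i, j) : i < j}` from `[n]`. -/
abbrev Pairs (n : ℕ) : Type := {p : Fin n × Fin n // p.1 < p.2}

/-- Inner products of differences in an `ℓ₂²` metric are bounded by the squared distances. -/
lemma abs_inner_sub_le_of_sq_triangle {ι E : Type*} [NormedAddCommGroup E]
    [InnerProductSpace ℝ E] (x : ι → E)
    (htri : ∀ i j k, ‖x i - x k‖ ^ 2 ≤ ‖x i - x j‖ ^ 2 + ‖x j - x k‖ ^ 2) (i j k l : ι) :
    |⟪x i - x j, x k - x l⟫| ≤ ‖x i - x j‖ ^ 2 := by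
  have key : 2 * ⟪x i - x j, x k - x l⟫ =
      ‖x i - x l‖ ^ 2 + ‖x j - x k‖ ^ 2 - ‖x i - x k‖ ^ 2 - ‖x j - x l‖ ^ 2 := by
    simp only [norm_sub_sq_real, inner_sub_left, inner_sub_right]
    ring
  have h₁ := htri i j l
  have h₂ := htri j i k
  have h₃ := htri i j k
  have h₄ := htri j i l
  rw [norm_sub_rev (x j) (x i)] at h₂ h₄
  rw [abs_le]
  constructor <;> linarith

lemma Matrix.IsHermitian.sum_sq_entries_eq_sum_sq_eigenvalues {ι : Type*} [Fintype ι]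
    [DecidableEq ι] {A : Matrix ι ι ℝ} (hA : A.IsHermitian) :
    ∑ i, ∑ j, A i j ^ 2 = ∑ i, hA.eigenvalues i ^ 2 := by
  have h₁ : ∑ i, ∑ j, A i j ^ 2 = (A * A).trace := by
    simp only [Matrix.trace, Matrix.diag_apply, Matrix.mul_apply]
    refine sum_congr rfl fun i _ => sum_congr rfl fun j _ => ?_
    rw [sq]
    congr 1
    simpa using (hA.apply i j).symm
  have h₂ : (A * A).trace =
      (Matrix.diagonal hA.eigenvalues * Matrix.diagonal hA.eigenvalues).trace := by
    conv_lhs => rw [hA.spectral_theorem]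
    rw [← map_mul, Unitary.conjStarAlgAut_apply, Matrix.trace_mul_cycle]
    simp
  rw [h₁, h₂, Matrix.diagonal_mul_diagonal, Matrix.trace_diagonal]
  exact sum_congr rfl fun i _ => (sq _).symm

/-- The ℓ₁ ratio of the embedding `y` is at most `Φ(SDP) · r · (∑_t σ_t / ∑_{t≤r} σ_t)²`, where
`σ_1 ≥ … ≥ σ_N` are the descending eigenvalues of the Gram matrix of
`{√(d_{ij}) (x i − x j)}_{i<j}`. -/
theorem stmt_8 {m n N : ℕ} (x : Fin n → EuclideanSpace ℝ (Fin m))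
    (htri : ∀ i j k : Fin n, ‖x i - x k‖ ^ 2 ≤ ‖x i - x j‖ ^ 2 + ‖x j - x k‖ ^ 2)
    (c dem : Fin n → Fin n → ℝ)
    (hc : ∀ i j : Fin n, i < j → 0 ≤ c i j) (hdem : ∀ i j : Fin n, i < j → 0 ≤ dem i j)
    (D : ℝ) (hD : D = ∑ p : Pairs n, dem p.1.1 p.1.2 * ‖x p.1.1 - x p.1.2‖ ^ 2)
    (hDpos : 0 < D)
    (G : Matrix (Pairs n) (Pairs n) ℝ)
    (hGdef : ∀ p q : Pairs n, G p q =
      ⟪Real.sqrt (dem p.1.1 p.1.2) • (x p.1.1 - x p.1.2),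
        Real.sqrt (dem q.1.1 q.1.2) • (x q.1.1 - x q.1.2)⟫)
    (hG : G.IsHermitian)
    (σ : Fin N → ℝ) (e : Fin N ≃ Pairs n)
    (hσ : ∀ t, σ t = hG.eigenvalues (e t))
    (hdesc : Antitone σ)
    (r : ℕ) (hr : 1 ≤ r) (hrN : r ≤ N)
    (hrpos : 0 < ∑ t ∈ univ.filter (fun t : Fin N => (t : ℕ) < r), σ t)
    (y : Fin n → Pairs n → ℝ)
    (hy : ∀ (i : Fin n) (p : Pairs n),
      y i p = dem p.1.1 p.1.2 * ‖x p.1.1 - x p.1.2‖ ^ 2 * ⟪x i - x p.1.2, x p.1.1 - x p.1.2⟫ / D) :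
    0 < ∑ p : Pairs n, dem p.1.1 p.1.2 * ∑ q : Pairs n, |y p.1.1 q - y p.1.2 q| ∧
      (∑ p : Pairs n, c p.1.1 p.1.2 * ∑ q : Pairs n, |y p.1.1 q - y p.1.2 q|) /
          (∑ p : Pairs n, dem p.1.1 p.1.2 * ∑ q : Pairs n, |y p.1.1 q - y p.1.2 q|) ≤
        ((∑ p : Pairs n, c p.1.1 p.1.2 * ‖x p.1.1 - x p.1.2‖ ^ 2) / D) * (r : ℝ) *
          ((∑ t, σ t) / ∑ t ∈ univ.filter (fun t : Fin N => (t : ℕ) < r), σ t) ^ 2 := by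
  have hdp : ∀ p : Pairs n, 0 ≤ dem p.1.1 p.1.2 := fun p => hdem _ _ p.2
  set S := ∑ t ∈ univ.filter (fun t : Fin N => (t : ℕ) < r), σ t with hS
  set P := ∑ p : Pairs n, c p.1.1 p.1.2 * ∑ q : Pairs n, |y p.1.1 q - y p.1.2 q| with hP
  set Q := ∑ p : Pairs n, dem p.1.1 p.1.2 * ∑ q : Pairs n, |y p.1.1 q - y p.1.2 q| with hQ
  set C := ∑ p : Pairs n, c p.1.1 p.1.2 * ‖x p.1.1 - x p.1.2‖ ^ 2 with hC
  have hrpos' : (0 : ℝ) < r := by exact_mod_cast hr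
  have hydiff : ∀ i j (q : Pairs n), |y i q - y j q| =
      dem q.1.1 q.1.2 * ‖x q.1.1 - x q.1.2‖ ^ 2 * |⟪x i - x j, x q.1.1 - x q.1.2⟫| / D := by
    intro i j q
    rw [hy, hy, ← sub_div, ← mul_sub, ← inner_sub_left, sub_sub_sub_cancel_right, abs_div,
      abs_mul, abs_of_pos hDpos, abs_of_nonneg (mul_nonneg (hdp q) (sq_nonneg _))]
  have hycontr : ∀ i j, ∑ q : Pairs n, |y i q - y j q| ≤ ‖x i - x j‖ ^ 2 := by
    intro i j
    calc ∑ q : Pairs n, |y i q - y j q|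
        ≤ ∑ q : Pairs n,
            dem q.1.1 q.1.2 * ‖x q.1.1 - x q.1.2‖ ^ 2 * ‖x i - x j‖ ^ 2 / D := by
          refine sum_le_sum fun q _ => ?_
          rw [hydiff]
          have := hdp q
          gcongr
          exact abs_inner_sub_le_of_sq_triangle x htri _ _ _ _
      _ = ‖x i - x j‖ ^ 2 := by
          rw [← sum_div, ← sum_mul, ← hD, mul_div_cancel_left₀ _ hDpos.ne']
  have hPC : P ≤ C := sum_le_sum fun p _ =>
    mul_le_mul_of_nonneg_left (hycontr _ _) (hc _ _ p.2)
  have hC0 : 0 ≤ C := sum_nonneg fun p _ => mul_nonneg (hc _ _ p.2) (sq_nonneg _)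
  have hGsq : ∀ p q : Pairs n, G p q ^ 2 =
      dem p.1.1 p.1.2 * dem q.1.1 q.1.2 * ⟪x p.1.1 - x p.1.2, x q.1.1 - x q.1.2⟫ ^ 2 := by
    intro p q
    rw [hGdef, real_inner_smul_left, real_inner_smul_right, mul_pow, mul_pow,
      Real.sq_sqrt (hdp p), Real.sq_sqrt (hdp q), mul_assoc]
  have hGQ : (∑ p, ∑ q, G p q ^ 2) / D ≤ Q := by
    rw [sum_div]
    refine sum_le_sum fun p _ => ?_
    rw [sum_div, mul_sum]
    refine sum_le_sum fun q _ => ?_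
    have hp := hdp p
    have hq := hdp q
    rw [hydiff, hGsq, ← mul_div_assoc]
    have h : |⟪x p.1.1 - x p.1.2, x q.1.1 - x q.1.2⟫| ≤ ‖x q.1.1 - x q.1.2‖ ^ 2 := by
      rw [real_inner_comm]
      exact abs_inner_sub_le_of_sq_triangle x htri _ _ _ _
    rw [← sq_abs, sq |⟪_, _⟫|, mul_assoc, mul_assoc (dem q.1.1 q.1.2)]
    gcongr
  have htrace : ∑ t, σ t = D := by
    have h := hG.trace_eq_sum_eigenvalues
    simp only [RCLike.ofReal_real_eq_id, id_eq] at h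
    rw [sum_congr rfl fun t _ => hσ t, e.sum_comp hG.eigenvalues, ← h, hD]
    refine sum_congr rfl fun p _ => ?_
    rw [Matrix.diag_apply, hGdef, real_inner_smul_left, real_inner_smul_right,
      real_inner_self_eq_norm_sq, ← mul_assoc, Real.mul_self_sqrt (hdp p)]
  have hsq : ∑ p, ∑ q, G p q ^ 2 = ∑ t, σ t ^ 2 := by
    rw [sum_congr rfl fun t _ => congrArg (· ^ 2) (hσ t),
      e.sum_comp fun p => hG.eigenvalues p ^ 2]
    convert hG.sum_sq_entries_eq_sum_sq_eigenvalues
  have hcard : #(univ.filter fun t : Fin N => (t : ℕ) < r) ≤ r := by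
    simpa using card_le_card_of_injOn (t := range r) (fun t : Fin N => (t : ℕ))
      (s := univ.filter fun t : Fin N => (t : ℕ) < r) (by intro t; simp) (Fin.val_injective.injOn)
  have hCS : S ^ 2 ≤ r * ∑ t, σ t ^ 2 := by
    refine sq_sum_le_card_mul_sum_sq.trans ?_
    gcongr
    exact subset_univ _
  have hQlow : S ^ 2 / (r * D) ≤ Q := by
    refine le_trans ?_ hGQ
    rw [hsq, div_le_div_iff₀ (by positivity) hDpos]
    nlinarith
  have hlow : 0 < S ^ 2 / (r * D) := by positivity
  refine ⟨hlow.trans_le hQlow, ?_⟩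
  calc P / Q ≤ C / (S ^ 2 / (r * D)) := div_le_div₀ hC0 hPC hlow hQlow
    _ = C / D * r * ((∑ t, σ t) / S) ^ 2 := by
      rw [htrace]
      field_simp
end

section
/- Let c_{ij}, d_{ij} ≥ 0 (1 ≤ i < j ≤ n) be cost and demand weights, let x_1, …, x_n ∈ ℝ^m satisfy the ℓ₂² triangle inequalities with D = Σ_{i<j} d_{ij} ‖x_i − x_j‖² > 0, and set Φ(SDP) = (Σ_{i<j} c_{ij} ‖x_i − x_j‖²) / D. Suppose λ > Φ(SDP) and there exists a linear subspace Z ⊆ ℝ^n with dim Z ≤ r (r ≥ 1) such that Σ_{i<j} c_{ij} (w_i − w_j)² ≥ λ · Σ_{i<j} d_{ij} (w_i − w_j)² for every w ∈ ℝ^n orthogonal to Z. Then there exists a subset S ⊆ [n] with Σ_{i<j} d_{ij} |1_S(i) − 1_S(j)| > 0 and sparsity Φ(S) = (Σ_{i<j} c_{ij} |1_S(i) − 1_S(j)|) / (Σ_{i<j} d_{ij} |1_S(i) − 1_S(j)|) ≤ Φ(SDP) · r · (1 − Φ(SDP)/λ)^{−2}. -/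
open RealInnerProductSpace

/-- A signed weighting of pairs that is nonnegative on all cuts is nonnegative on all line
metrics. -/
theorem sum_mul_abs_sub_nonneg_of_cuts {V ι : Type*} [Fintype V] [DecidableEq V] [Fintype ι]
    (u v : ι → V)
    (e : ι → ℝ) (h : ∀ S : Finset V, 0 ≤ ∑ p, e p *
      |(if u p ∈ S then (1 : ℝ) else 0) - (if v p ∈ S then (1 : ℝ) else 0)|)
    (f : V → ℝ) : 0 ≤ ∑ p, e p * |f (u p) - f (v p)| := by
  classical
  let χ : ι → ℝ → ℝ := fun p =>
    (Set.Ico (min (f (u p)) (f (v p))) (max (f (u p)) (f (v p)))).indicator 1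
  have hχint (p : ι) : ∫ t, χ p t = |f (u p) - f (v p)| := by
    rw [MeasureTheory.integral_indicator_one measurableSet_Ico, Real.volume_real_Ico,
      max_sub_min_eq_abs, max_eq_left (abs_nonneg _), abs_sub_comm]
  have hχable (p : ι) : MeasureTheory.Integrable (χ p) :=
    (MeasureTheory.integrable_indicator_iff measurableSet_Ico).2
      (MeasureTheory.integrableOn_const (by simp))
  have hχeq (t : ℝ) (p : ι) : χ p t =
      |(if u p ∈ Finset.univ.filter (f · ≤ t) then (1 : ℝ) else 0) -
        (if v p ∈ Finset.univ.filter (f · ≤ t) then (1 : ℝ) else 0)| := by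
    simp only [χ, Set.indicator_apply, Set.mem_Ico, min_le_iff, lt_max_iff, Finset.mem_filter,
      Finset.mem_univ, true_and, Pi.one_apply]
    by_cases h₁ : f (u p) ≤ t <;> by_cases h₂ : f (v p) ≤ t <;> simp [h₁, h₂]
  calc 0 ≤ ∫ t, ∑ p, e p * χ p t := by
        refine MeasureTheory.integral_nonneg fun t => ?_
        simp only [hχeq t]
        exact h (Finset.univ.filter (f · ≤ t))
    _ = ∑ p, e p * |f (u p) - f (v p)| := by
        rw [MeasureTheory.integral_finsetSum _ fun p _ => (hχable p).const_mul (e p)]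
        simp only [MeasureTheory.integral_const_mul, hχint]

/-- Some cut is at most as sparse as a given line metric with positive demand. -/
theorem exists_cut_of_line_metric {V ι : Type*} [Fintype V] [DecidableEq V] [Fintype ι]
    (u v : ι → V)
    (c d : ι → ℝ) (hd : ∀ p, 0 ≤ d p) (hc : ∀ p, 0 ≤ c p) (f : V → ℝ) (R : ℝ)
    (hpos : 0 < ∑ p, d p * |f (u p) - f (v p)|)
    (hle : ∑ p, c p * |f (u p) - f (v p)| ≤ R * ∑ p, d p * |f (u p) - f (v p)|) :
    ∃ S : Finset V,
      0 < ∑ p, d p * |(if u p ∈ S then (1 : ℝ) else 0) - (if v p ∈ S then (1 : ℝ) else 0)| ∧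
      (∑ p, c p * |(if u p ∈ S then (1 : ℝ) else 0) - (if v p ∈ S then (1 : ℝ) else 0)|) /
        (∑ p, d p * |(if u p ∈ S then (1 : ℝ) else 0) - (if v p ∈ S then (1 : ℝ) else 0)|) ≤
        R := by
  classical
  set cut : (ι → ℝ) → Finset V → ℝ := fun e S =>
    ∑ p, e p * |(if u p ∈ S then (1 : ℝ) else 0) - (if v p ∈ S then (1 : ℝ) else 0)| with hcut
  let 𝒮 : Finset (Finset V) := Finset.univ.filter fun S => 0 < cut d S
  have hne : 𝒮.Nonempty := by
    by_contra! hempty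
    have hzero (S : Finset V) : cut d S ≤ 0 := by
      by_contra! hS
      have : S ∈ 𝒮 := by simpa [𝒮] using hS
      simp [hempty] at this
    have := sum_mul_abs_sub_nonneg_of_cuts u v (fun p => - d p)
      (fun S => by simpa [hcut, neg_mul, Finset.sum_neg_distrib] using hzero S) f
    simp only [neg_mul, Finset.sum_neg_distrib] at this
    linarith
  obtain ⟨S, hS, hmin⟩ := 𝒮.exists_min_image (fun S => cut c S / cut d S) hne
  have hS' : 0 < cut d S := by simpa [𝒮] using hS
  refine ⟨S, hS', ?_⟩
  change cut c S / cut d S ≤ R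
  have key := sum_mul_abs_sub_nonneg_of_cuts u v (fun p => c p - cut c S / cut d S * d p)
    (fun T => by
      have hT : 0 ≤ cut c T - cut c S / cut d S * cut d T := by
        rcases (show 0 ≤ cut d T from
          Finset.sum_nonneg fun p _ => mul_nonneg (hd p) (abs_nonneg _)).eq_or_lt with h0 | h0
        · rw [← h0, mul_zero, sub_zero]
          exact Finset.sum_nonneg fun p _ => mul_nonneg (hc p) (abs_nonneg _)
        · have := hmin T (by simpa [𝒮] using h0)
          rw [le_div_iff₀ h0] at this
          linarith
      simpa only [hcut, sub_mul, Finset.sum_sub_distrib, mul_assoc, ← Finset.mul_sum] using hT) f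
  simp only [sub_mul, Finset.sum_sub_distrib, mul_assoc, ← Finset.mul_sum] at key
  exact le_of_mul_le_mul_right (by linarith) hpos

/-- If `lam` times the `d`-weighted energy of a family of vectors is at most its `c`-weighted
energy in every direction orthogonal to a subspace of dimension at most `r`, then the `d`-weighted
Gram matrix has large Frobenius norm. -/
theorem sq_le_mul_sum_inner_sq {E ι : Type*} [NormedAddCommGroup E] [InnerProductSpace ℝ E]
    [FiniteDimensional ℝ E] [Fintype ι] (a : ι → E) (c d : ι → ℝ) (hc : ∀ p, 0 ≤ c p)
    (W : Submodule ℝ E) (r : ℕ) (hW : Module.finrank ℝ W ≤ r) (lam : ℝ) (hlam : 0 < lam)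
    (hquad : ∀ q ∈ Wᗮ, lam * ∑ p, d p * ⟪a p, q⟫ ^ 2 ≤ ∑ p, c p * ⟪a p, q⟫ ^ 2)
    (hle : ∑ p, c p * ‖a p‖ ^ 2 ≤ lam * ∑ p, d p * ‖a p‖ ^ 2) :
    (∑ p, d p * ‖a p‖ ^ 2 - (∑ p, c p * ‖a p‖ ^ 2) / lam) ^ 2 ≤
      r * ∑ p, ∑ q, d p * d q * ⟪a p, a q⟫ ^ 2 := by
  classical
  let b := ((stdOrthonormalBasis ℝ W).prod (stdOrthonormalBasis ℝ Wᗮ)).map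
    W.orthogonalDecomposition.symm
  have hb (j) : b (Sum.inr j) ∈ Wᗮ := by
    simp [b]
  have hnorm (e : ι → ℝ) : ∑ p, e p * ‖a p‖ ^ 2 = ∑ t, ∑ p, e p * ⟪a p, b t⟫ ^ 2 := by
    rw [Finset.sum_comm]
    refine Finset.sum_congr rfl fun p _ => ?_
    rw [← Finset.mul_sum, ← b.sum_sq_norm_inner_left]
    simp
  have hgram : ∑ p, ∑ q, d p * d q * ⟪a p, a q⟫ ^ 2 =
      ∑ s, ∑ t, (∑ p, d p * ⟪a p, b s⟫ * ⟪a p, b t⟫) ^ 2 := by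
    have h₁ (p q : ι) : ⟪a p, a q⟫ ^ 2 =
        ∑ s, ∑ t, (⟪a p, b s⟫ * ⟪a q, b s⟫) * (⟪a p, b t⟫ * ⟪a q, b t⟫) := by
      rw [sq, ← b.sum_inner_mul_inner, Finset.sum_mul_sum]
      simp only [real_inner_comm]
    have h₂ (s t) : (∑ p, d p * ⟪a p, b s⟫ * ⟪a p, b t⟫) ^ 2 =
        ∑ p, ∑ q, d p * d q * ((⟪a p, b s⟫ * ⟪a q, b s⟫) * (⟪a p, b t⟫ * ⟪a q, b t⟫)) := by
      rw [sq, Finset.sum_mul_sum]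
      exact Finset.sum_congr rfl fun p _ => Finset.sum_congr rfl fun q _ => by ring
    simp only [h₁, h₂, Finset.mul_sum]
    exact Finset.sum_comm_cycle.trans (Finset.sum_congr rfl fun s _ => Finset.sum_comm_cycle)
  have htail : lam * ∑ j, ∑ p, d p * ⟪a p, b (Sum.inr j)⟫ ^ 2 ≤ ∑ p, c p * ‖a p‖ ^ 2 := by
    rw [hnorm c, Fintype.sum_sum_type, Finset.mul_sum]
    refine (Finset.sum_le_sum fun j _ => hquad _ (hb j)).trans (le_add_of_nonneg_left ?_)
    exact Finset.sum_nonneg fun i _ => Finset.sum_nonneg fun p _ =>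
      mul_nonneg (hc p) (sq_nonneg _)
  have hhead : ∑ p, d p * ‖a p‖ ^ 2 - (∑ p, c p * ‖a p‖ ^ 2) / lam ≤
      ∑ i, ∑ p, d p * ⟪a p, b (Sum.inl i)⟫ ^ 2 := by
    have h₁ := hnorm d
    rw [Fintype.sum_sum_type] at h₁
    have h₂ := (le_div_iff₀' hlam).2 htail
    linarith
  have hnonneg : 0 ≤ ∑ p, d p * ‖a p‖ ^ 2 - (∑ p, c p * ‖a p‖ ^ 2) / lam :=
    sub_nonneg.2 ((div_le_iff₀' hlam).2 hle)
  calc _ ≤ (∑ i, ∑ p, d p * ⟪a p, b (Sum.inl i)⟫ ^ 2) ^ 2 := pow_le_pow_left₀ hnonneg hhead 2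
    _ ≤ Module.finrank ℝ W * ∑ i, (∑ p, d p * ⟪a p, b (Sum.inl i)⟫ ^ 2) ^ 2 := by
      simpa using sq_sum_le_card_mul_sum_sq (s := Finset.univ)
        (f := fun i => ∑ p, d p * ⟪a p, b (Sum.inl i)⟫ ^ 2)
    _ ≤ r * ∑ s, ∑ t, (∑ p, d p * ⟪a p, b s⟫ * ⟪a p, b t⟫) ^ 2 := by
      have hdiag (s) : (∑ p, d p * ⟪a p, b s⟫ ^ 2) ^ 2 ≤
          ∑ t, (∑ p, d p * ⟪a p, b s⟫ * ⟪a p, b t⟫) ^ 2 := by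
        simpa only [sq, mul_assoc] using Finset.single_le_sum
          (f := fun t => (∑ p, d p * ⟪a p, b s⟫ * ⟪a p, b t⟫) ^ 2)
          (fun t _ => sq_nonneg _) (Finset.mem_univ s)
      refine mul_le_mul (by exact_mod_cast hW) ?_
        (Finset.sum_nonneg fun i _ => sq_nonneg _) (Nat.cast_nonneg r)
      rw [Fintype.sum_sum_type]
      exact (Finset.sum_le_sum fun i _ => hdiag _).trans (le_add_of_nonneg_right
        (Finset.sum_nonneg fun i _ => Finset.sum_nonneg fun t _ => sq_nonneg _))
    _ = _ := by rw [hgram]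

/-- Under the `ℓ₂²` triangle inequalities, projecting onto a difference of two points contracts
squared distances. -/
theorem abs_inner_sub_sub_le_norm_sq {E V : Type*} [NormedAddCommGroup E] [InnerProductSpace ℝ E]
    (x : V → E) (htri : ∀ i j k, ‖x i - x k‖ ^ 2 ≤ ‖x i - x j‖ ^ 2 + ‖x j - x k‖ ^ 2)
    (i j k l : V) : |⟪x i - x j, x k - x l⟫| ≤ ‖x i - x j‖ ^ 2 := by
  have hpolar : 2 * ⟪x i - x j, x k - x l⟫ =
      ‖x i - x l‖ ^ 2 + ‖x j - x k‖ ^ 2 - ‖x i - x k‖ ^ 2 - ‖x j - x l‖ ^ 2 := by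
    simp only [norm_sub_sq_real, inner_sub_left, inner_sub_right]
    ring
  have h₁ := htri i j l
  have h₂ := htri j i k
  have h₃ := htri i j k
  have h₄ := htri j i l
  rw [norm_sub_rev (x j) (x i)] at h₂ h₄
  rw [abs_le]
  constructor <;> linarith

/-- In a family of vectors with large weighted Gram matrix whose inner products are bounded by
squared norms, some member has large weighted correlation with the family. -/
theorem exists_le_sum_mul_abs_inner {E ι : Type*} [NormedAddCommGroup E] [InnerProductSpace ℝ E]
    [Fintype ι] (a : ι → E) (d : ι → ℝ) (hd : ∀ p, 0 ≤ d p)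
    (hcontr : ∀ p q, |⟪a p, a q⟫| ≤ ‖a p‖ ^ 2) (hpos : 0 < ∑ p, d p * ‖a p‖ ^ 2) (K : ℝ)
    (hK : K * ∑ p, d p * ‖a p‖ ^ 2 ≤ ∑ p, ∑ q, d p * d q * ⟪a p, a q⟫ ^ 2) :
    ∃ q, K ≤ ∑ p, d p * |⟪a p, a q⟫| := by
  by_contra! hlt
  obtain ⟨q₀, -, hq₀⟩ : ∃ q ∈ Finset.univ, 0 < d q * ‖a q‖ ^ 2 :=
    Finset.exists_lt_of_sum_lt (by simpa using hpos)
  refine hK.not_gt ?_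
  calc ∑ p, ∑ q, d p * d q * ⟪a p, a q⟫ ^ 2
      ≤ ∑ p, d p * ‖a p‖ ^ 2 * ∑ q, d q * |⟪a q, a p⟫| := by
        refine Finset.sum_le_sum fun p _ => ?_
        rw [Finset.mul_sum]
        refine Finset.sum_le_sum fun q _ => ?_
        rw [← sq_abs, real_inner_comm (a p) (a q), sq]
        calc d p * d q * (|⟪a p, a q⟫| * |⟪a p, a q⟫|)
            ≤ d p * d q * (‖a p‖ ^ 2 * |⟪a p, a q⟫|) :=
              mul_le_mul_of_nonneg_left
                (mul_le_mul_of_nonneg_right (hcontr p q) (abs_nonneg _))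
                (mul_nonneg (hd p) (hd q))
          _ = _ := by ring
    _ < ∑ p, d p * ‖a p‖ ^ 2 * K :=
        Finset.sum_lt_sum
          (fun p _ => mul_le_mul_of_nonneg_left (hlt p).le (mul_nonneg (hd p) (sq_nonneg _)))
          ⟨q₀, Finset.mem_univ _, mul_lt_mul_of_pos_left (hlt q₀) hq₀⟩
    _ = K * ∑ p, d p * ‖a p‖ ^ 2 := by rw [← Finset.sum_mul, mul_comm]

/-- Main theorem: given an ℓ₂²-feasible SDP solution with value `Φ(SDP)` and a subspace `Z` of
dimension at most `r` witnessing `λ ≤ λ_{r+1}` with `λ > Φ(SDP)`, there is a cut `S` of sparsity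
at most `Φ(SDP) · r · (1 − Φ(SDP)/λ)⁻²`. -/
theorem stmt_10 {m n r : ℕ} (x : Fin n → EuclideanSpace ℝ (Fin m))
    (htri : ∀ i j k : Fin n, ‖x i - x k‖ ^ 2 ≤ ‖x i - x j‖ ^ 2 + ‖x j - x k‖ ^ 2)
    (c dem : Fin n → Fin n → ℝ)
    (hc : ∀ i j : Fin n, i < j → 0 ≤ c i j) (hdem : ∀ i j : Fin n, i < j → 0 ≤ dem i j)
    (D : ℝ) (hD : D = ∑ p : Pairs n, dem p.1.1 p.1.2 * ‖x p.1.1 - x p.1.2‖ ^ 2)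
    (hDpos : 0 < D)
    (Φ : ℝ) (hΦ : Φ = (∑ p : Pairs n, c p.1.1 p.1.2 * ‖x p.1.1 - x p.1.2‖ ^ 2) / D)
    (lam : ℝ) (hlam : Φ < lam) (hr : 1 ≤ r)
    (Z : Submodule ℝ (EuclideanSpace ℝ (Fin n))) (hZ : Module.finrank ℝ Z ≤ r)
    (hquad : ∀ w : EuclideanSpace ℝ (Fin n), w ∈ Zᗮ →
      lam * ∑ p : Pairs n, dem p.1.1 p.1.2 * (w p.1.1 - w p.1.2) ^ 2 ≤
        ∑ p : Pairs n, c p.1.1 p.1.2 * (w p.1.1 - w p.1.2) ^ 2) :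
    ∃ S : Finset (Fin n),
      0 < ∑ p : Pairs n, dem p.1.1 p.1.2 *
          |(if p.1.1 ∈ S then (1 : ℝ) else 0) - (if p.1.2 ∈ S then (1 : ℝ) else 0)| ∧
        (∑ p : Pairs n, c p.1.1 p.1.2 *
            |(if p.1.1 ∈ S then (1 : ℝ) else 0) - (if p.1.2 ∈ S then (1 : ℝ) else 0)|) /
          (∑ p : Pairs n, dem p.1.1 p.1.2 *
            |(if p.1.1 ∈ S then (1 : ℝ) else 0) - (if p.1.2 ∈ S then (1 : ℝ) else 0)|) ≤
          Φ * (r : ℝ) * ((1 - Φ / lam)⁻¹) ^ 2 := by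
  have hΦ₀ : 0 ≤ Φ := by
    rw [hΦ]
    exact div_nonneg (Finset.sum_nonneg fun p _ => mul_nonneg (hc _ _ p.2) (sq_nonneg _)) hDpos.le
  have hlam₀ : 0 < lam := hΦ₀.trans_lt hlam
  have hr₀ : (0 : ℝ) < r := by exact_mod_cast hr
  have hcost : ∑ p : Pairs n, c p.1.1 p.1.2 * ‖x p.1.1 - x p.1.2‖ ^ 2 = Φ * D := by
    rw [hΦ, div_mul_cancel₀ _ hDpos.ne']
  have hδ : 0 < 1 - Φ / lam := sub_pos.2 ((div_lt_one hlam₀).2 hlam)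
  let T : EuclideanSpace ℝ (Fin n) →ₗ[ℝ] EuclideanSpace ℝ (Fin m) :=
    (Fintype.linearCombination ℝ x).comp (WithLp.linearEquiv 2 ℝ (Fin n → ℝ)).toLinearMap
  have hgram := sq_le_mul_sum_inner_sq (fun p : Pairs n => x p.1.1 - x p.1.2)
    (fun p => c p.1.1 p.1.2) (fun p => dem p.1.1 p.1.2) (fun p => hc _ _ p.2) (Z.map T) r
    ((Submodule.finrank_map_le T Z).trans hZ) lam hlam₀
    (fun q hq => by
      have hw : WithLp.toLp 2 (fun i => ⟪x i, q⟫) ∈ Zᗮ := by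
        intro z hz
        have := hq (T z) (Submodule.mem_map_of_mem hz)
        rw [PiLp.inner_apply]
        simpa [T, Fintype.linearCombination_apply, sum_inner, real_inner_smul_left,
          mul_comm] using this
      simpa only [inner_sub_left] using hquad _ hw)
    (by rw [hcost, ← hD]; exact mul_le_mul_of_nonneg_right hlam.le hDpos.le)
  rw [hcost, ← hD] at hgram
  have hK : 0 < (1 - Φ / lam) ^ 2 * D / r := by positivity
  obtain ⟨q, hq⟩ := exists_le_sum_mul_abs_inner (fun p : Pairs n => x p.1.1 - x p.1.2)
    (fun p => dem p.1.1 p.1.2) (fun p => hdem _ _ p.2)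
    (fun p q => abs_inner_sub_sub_le_norm_sq x htri _ _ _ _) (hD ▸ hDpos)
    ((1 - Φ / lam) ^ 2 * D / r) (by
      rw [← hD, div_mul_eq_mul_div, div_le_iff₀' hr₀]
      refine le_trans (le_of_eq ?_) hgram
      ring)
  refine exists_cut_of_line_metric (fun p : Pairs n => p.1.1) (fun p => p.1.2)
    (fun p => c p.1.1 p.1.2) (fun p => dem p.1.1 p.1.2) (fun p => hdem _ _ p.2)
    (fun p => hc _ _ p.2) (fun i => ⟪x i, x q.1.1 - x q.1.2⟫) _ ?_ ?_
  · simpa only [← inner_sub_left] using hK.trans_le hq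
  · simp only [← inner_sub_left]
    calc ∑ p : Pairs n, c p.1.1 p.1.2 * |⟪x p.1.1 - x p.1.2, x q.1.1 - x q.1.2⟫|
        ≤ Φ * D := by
          rw [← hcost]
          exact Finset.sum_le_sum fun p _ => mul_le_mul_of_nonneg_left
            (abs_inner_sub_sub_le_norm_sq x htri _ _ _ _) (hc _ _ p.2)
      _ = Φ * r * ((1 - Φ / lam)⁻¹) ^ 2 * ((1 - Φ / lam) ^ 2 * D / r) := by
          have := hδ.ne'
          generalize 1 - Φ / lam = δ at this ⊢
          field_simp
      _ ≤ _ := mul_le_mul_of_nonneg_left hq (by positivity)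
end
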